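/- There is a universal constant c > 0 such that the following holds. Let P ⊆ ℝ² be a finite set and let π = (q_0, …, q_m) be a path in the weighted unit-distance graph G of P such that ‖q_i − q_j‖ > 1 for all indices i, j with j ≥ i + 2. Then the shadow of the polygonal curve traced by π contains at least len(π)/c cells of Grid(1/8). -/

import Mathlib

open Metric Set

/-- A path in the weighted unit-distance graph of `P`: a finite sequence of points
of `P` in which consecutive points are at distance at most `1`. -/
def IsUDPath {α : Type*} [MetricSpace α] (P : Set α) (m : ℕ) (f : Fin (m + 1) → α) : Prop :=
  (∀ i, f i ∈ P) ∧ ∀ i : Fin m, dist (f i.castSucc) (f i.succ) ≤ 1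

/-- The length of a path: the sum of the lengths of its edges. -/
noncomputable def udLen {α : Type*} [MetricSpace α] (m : ℕ) (f : Fin (m + 1) → α) : ℝ :=
  ∑ i : Fin m, dist (f i.castSucc) (f i.succ)

/-- The cell of the grid of sidelength `1/8` indexed by `(a, b) ∈ ℤ²`: an
axis-aligned half-open square. -/
def gridCell (a b : ℤ) : Set (EuclideanSpace ℝ (Fin 2)) :=
  {x | (a : ℝ) / 8 ≤ x 0 ∧ x 0 < ((a : ℝ) + 1) / 8 ∧
       (b : ℝ) / 8 ≤ x 1 ∧ x 1 < ((b : ℝ) + 1) / 8}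

/-- The polygonal curve traced by a path: the union of its segments. -/
def udTrace (m : ℕ) (f : Fin (m + 1) → EuclideanSpace ℝ (Fin 2)) :
    Set (EuclideanSpace ℝ (Fin 2)) :=
  ⋃ i : Fin m, segment ℝ (f i.castSucc) (f i.succ)

/-- The shadow of a set `X ⊆ ℝ²`: the set of cells of the grid of sidelength `1/8`
(indexed by `ℤ²`) that intersect `X`. -/
def shadow (X : Set (EuclideanSpace ℝ (Fin 2))) : Set (ℤ × ℤ) :=
  {ab | (gridCell ab.1 ab.2 ∩ X).Nonempty}

/-- The index of the cell containing a point. -/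
noncomputable def cellOf (x : EuclideanSpace ℝ (Fin 2)) : ℤ × ℤ := (⌊8 * x 0⌋, ⌊8 * x 1⌋)

lemma mem_cellOf (x : EuclideanSpace ℝ (Fin 2)) : x ∈ gridCell (cellOf x).1 (cellOf x).2 := by
  have h0 := Int.floor_le (8 * x 0)
  have h1 := Int.lt_floor_add_one (8 * x 0)
  have h2 := Int.floor_le (8 * x 1)
  have h3 := Int.lt_floor_add_one (8 * x 1)
  simp only [gridCell, cellOf, Set.mem_ofPred_eq]
  refine ⟨?_, ?_, ?_, ?_⟩ <;> linarith

lemma dist_le_of_mem_gridCell {a b : ℤ} {x y : EuclideanSpace ℝ (Fin 2)}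
    (hx : x ∈ gridCell a b) (hy : y ∈ gridCell a b) : dist x y ≤ 1 := by
  obtain ⟨x1, x2, x3, x4⟩ := hx
  obtain ⟨y1, y2, y3, y4⟩ := hy
  rw [EuclideanSpace.dist_eq, Fin.sum_univ_two, Real.dist_eq, Real.dist_eq, sq_abs, sq_abs,
    Real.sqrt_le_iff, one_pow]
  have h0 : (x 0 - y 0) ^ 2 ≤ (1 / 8) ^ 2 := by
    apply sq_le_sq' <;> linarith
  have h1 : (x 1 - y 1) ^ 2 ≤ (1 / 8) ^ 2 := by
    apply sq_le_sq' <;> linarith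
  exact ⟨zero_le_one, by linarith⟩

lemma shadow_finite {X : Set (EuclideanSpace ℝ (Fin 2))} (hX : Bornology.IsBounded X) :
    (shadow X).Finite := by
  obtain ⟨R, hR⟩ := hX.exists_norm_le
  apply ((Set.finite_Icc (-⌈8 * R + 1⌉) ⌈8 * R + 1⌉).prod
    (Set.finite_Icc (-⌈8 * R + 1⌉) ⌈8 * R + 1⌉)).subset
  rintro ⟨a, b⟩ ⟨x, ⟨h1, h2, h3, h4⟩, hx⟩
  have hn := hR x hx
  have e0 := abs_le.1 ((Real.norm_eq_abs _ ▸ PiLp.norm_apply_le x 0).trans hn)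
  have e1 := abs_le.1 ((Real.norm_eq_abs _ ▸ PiLp.norm_apply_le x 1).trans hn)
  have hc := Int.le_ceil (8 * R + 1)
  dsimp only at h1 h2 h3 h4
  simp only [Set.mem_prod, Set.mem_Icc]
  refine ⟨⟨?_, ?_⟩, ?_, ?_⟩ <;> rify <;> linarith [e0.1, e0.2, e1.1, e1.2]

lemma udTrace_bounded (m : ℕ) (f : Fin (m + 1) → EuclideanSpace ℝ (Fin 2)) :
    Bornology.IsBounded (udTrace m f) := by
  unfold udTrace
  rw [Bornology.isBounded_iUnion]
  intro i
  rw [← convexHull_pair, isBounded_convexHull]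
  exact (Set.toFinite _).isBounded

/-- **Spread paths have large shadows.** There is a universal constant `c > 0` such
that any path in a unit-distance graph in the plane whose non-consecutive vertices are
at distance greater than `1` has a shadow with at least `len(π)/c` grid cells. -/
theorem spread_path_large_shadow :
    ∃ c : ℝ, 0 < c ∧
      ∀ (P : Set (EuclideanSpace ℝ (Fin 2))), P.Finite →
      ∀ (m : ℕ) (f : Fin (m + 1) → EuclideanSpace ℝ (Fin 2)),
        IsUDPath P m f →
        (∀ i j : Fin (m + 1), (i : ℕ) + 2 ≤ (j : ℕ) → 1 < dist (f i) (f j)) →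
        udLen m f / c ≤ ((shadow (udTrace m f)).ncard : ℝ) := by
  refine ⟨2, by norm_num, ?_⟩
  intro P _ m f hf hsp
  have hlen : udLen m f ≤ m := by
    unfold udLen
    calc _ ≤ ∑ _i : Fin m, (1 : ℝ) := Finset.sum_le_sum fun i _ => hf.2 i
      _ = m := by simp
  have hcard : (m + 1) / 2 ≤ (shadow (udTrace m f)).ncard := by
    let g : Fin ((m + 1) / 2) → ℤ × ℤ := fun k =>
      cellOf (f ⟨2 * k.1, by have := k.2; omega⟩)
    have key : ∀ k l : Fin ((m + 1) / 2), k.1 < l.1 → g k ≠ g l := by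
      intro k l hkl h
      have hd := hsp ⟨2 * k.1, by have := k.2; omega⟩ ⟨2 * l.1, by have := l.2; omega⟩
        (by simp only; omega)
      have hx := mem_cellOf (f ⟨2 * k.1, by have := k.2; omega⟩)
      have hy := mem_cellOf (f ⟨2 * l.1, by have := l.2; omega⟩)
      change _ ∈ gridCell (g k).1 (g k).2 at hx
      change _ ∈ gridCell (g l).1 (g l).2 at hy
      rw [h] at hx
      exact absurd (dist_le_of_mem_gridCell hx hy) (not_le.2 hd)
    have hg : Function.Injective g := by
      intro k l h
      rcases lt_trichotomy k.1 l.1 with h1 | h1 | h1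
      · exact absurd h (key k l h1)
      · exact Fin.ext h1
      · exact absurd h.symm (key l k h1)
    have hsub : Set.range g ⊆ shadow (udTrace m f) := by
      rintro _ ⟨k, rfl⟩
      refine ⟨_, mem_cellOf _, ?_⟩
      exact Set.mem_iUnion.2 ⟨⟨2 * k.1, by have := k.2; omega⟩, left_mem_segment ℝ _ _⟩
    have h := Set.ncard_le_ncard hsub (shadow_finite (udTrace_bounded m f))
    rw [← Set.image_univ, Set.ncard_image_of_injective _ hg, Set.ncard_univ] at h
    simpa using h
  have h2 : m ≤ 2 * (shadow (udTrace m f)).ncard := by omega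
  have h3 : (m : ℝ) ≤ 2 * ((shadow (udTrace m f)).ncard : ℝ) := by exact_mod_cast h2
  linarith
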